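/- arXiv:2306.14449 — 8 statements merged into one kernel-verified Lean document; each statement's English description precedes it below -/
import Mathlib

section
/- Let (M,d) be a metric space, let ρ be a scale function with β₁(ρ) ≥ 1, and assume (M,d) satisfies the ρ-chain condition. Then for every x ∈ M, the set R_x := {r > 0 : there exists ξ ∈ M with d(x,ξ) = r} is dense in the open interval (0, sup_{ξ∈M} d(x,ξ)). -/
open scoped ENNReal

/-- A scale function with constant `C` and exponents `β₁ ≤ β₂`:
a positive, continuous, strictly increasing function on `(0,∞)` tending to `0`
at `0⁺` and to `∞` at `∞`, with two-sided power-type comparison. -/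
structure IsScale (φ : ℝ → ℝ) (C β₁ β₂ : ℝ) : Prop where
  one_le_C : 1 ≤ C
  beta1_pos : 0 < β₁
  beta_le : β₁ ≤ β₂
  pos : ∀ r : ℝ, 0 < r → 0 < φ r
  cont : ContinuousOn φ (Set.Ioi 0)
  mono : StrictMonoOn φ (Set.Ioi 0)
  tendsto_zero : Filter.Tendsto φ (nhdsWithin 0 (Set.Ioi 0)) (nhds 0)
  tendsto_top : Filter.Tendsto φ Filter.atTop Filter.atTop
  lower : ∀ s t : ℝ, 0 < s → s ≤ t → C⁻¹ * (t / s) ^ β₁ ≤ φ t / φ s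
  upper : ∀ s t : ℝ, 0 < s → s ≤ t → φ t / φ s ≤ C * (t / s) ^ β₂
/-- `ξ 0 = x, …, ξ (N+1) = y` is an `ε`-chain from `x` to `y`. -/
def IsChainSeq {M : Type*} [MetricSpace M] (ε : ℝ) (x y : M) (N : ℕ) (ξ : ℕ → M) : Prop :=
  ξ 0 = x ∧ ξ (N + 1) = y ∧ ∀ i ≤ N, dist (ξ i) (ξ (i + 1)) < ε

/-- The chain distance `d_ε(x,y)`: the infimum of total lengths of `ε`-chains from
`x` to `y`, equal to `∞` when no `ε`-chain exists. -/
noncomputable def chainDist {M : Type*} [MetricSpace M] (ε : ℝ) (x y : M) : ℝ≥0∞ :=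
  ⨅ (N : ℕ) (ξ : ℕ → M) (_ : IsChainSeq ε x y N ξ),
    ENNReal.ofReal (∑ i ∈ Finset.range (N + 1), dist (ξ i) (ξ (i + 1)))

/-- The `ρ`-chain condition with constant `Cρ`:
`Cρ⁻¹ ρ(d(x,y))/ρ(ε) ≤ d_ε(x,y)/ε ≤ Cρ ρ(d(x,y))/ρ(ε)` for all `0 < ε < d(x,y)`. -/
def RhoChainCond (M : Type*) [MetricSpace M] (ρ : ℝ → ℝ) (Cρ : ℝ) : Prop :=
  ∀ x y : M, ∀ ε : ℝ, 0 < ε → ε < dist x y →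
    ENNReal.ofReal (Cρ⁻¹ * (ρ (dist x y) / ρ ε) * ε) ≤ chainDist ε x y ∧
    chainDist ε x y ≤ ENNReal.ofReal (Cρ * (ρ (dist x y) / ρ ε) * ε)

/-- A finite chain distance is witnessed by an actual chain. -/
theorem exists_isChainSeq_of_chainDist_ne_top {M : Type*} [MetricSpace M] {ε : ℝ} {x y : M}
    (h : chainDist ε x y ≠ ⊤) : ∃ (N : ℕ) (ξ : ℕ → M), IsChainSeq ε x y N ξ := by
  contrapose! h
  simp [chainDist, h]

/-- An `ε`-chain leaving the ball of radius `r` about its starting point meets the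
annulus `r ≤ dist x z < r + ε`. -/
theorem IsChainSeq.exists_dist_mem_Ico {M : Type*} [MetricSpace M] {ε r : ℝ} {x y : M}
    {N : ℕ} {ξ : ℕ → M} (h : IsChainSeq ε x y N ξ) (hr : 0 < r) (hy : r ≤ dist x y) :
    ∃ z : M, dist x z ∈ Set.Ico r (r + ε) := by
  classical
  obtain ⟨h_start, h_end, h_step⟩ := h
  have hex : ∃ n, r ≤ dist x (ξ n) := ⟨N + 1, by rwa [h_end]⟩
  have h_le : Nat.find hex ≤ N + 1 := Nat.find_min' hex (by rwa [h_end])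
  have h_exit : r ≤ dist x (ξ (Nat.find hex)) := Nat.find_spec hex
  refine ⟨ξ (Nat.find hex), h_exit, ?_⟩
  obtain ⟨k, hk⟩ : ∃ k, Nat.find hex = k + 1 := by
    refine Nat.exists_eq_succ_of_ne_zero fun h0 => ?_
    rw [h0, h_start, dist_self] at h_exit
    exact absurd h_exit (not_le.mpr hr)
  have h_in : dist x (ξ k) < r := not_le.mp (Nat.find_min hex (by omega))
  rw [hk]
  linarith [dist_triangle x (ξ k) (ξ (k + 1)), h_step k (by omega)]

/-- If `(M,d)` satisfies the `ρ`-chain condition for a scale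
function `ρ` with `β₁(ρ) ≥ 1`, then for every `x ∈ M` the set
`R_x = {r > 0 : ∃ ξ, d(x,ξ) = r}` is dense in `(0, sup_ξ d(x,ξ))`. -/
theorem dense_radii {M : Type*} [MetricSpace M]
    (ρ : ℝ → ℝ) (C₀ γ₁ γ₂ Cρ : ℝ)
    (hρ : IsScale ρ C₀ γ₁ γ₂) (hγ₁ : 1 ≤ γ₁)
    (hCρ : 1 ≤ Cρ) (hchain : RhoChainCond M ρ Cρ) :
    ∀ x : M, ∀ r δ : ℝ, 0 < r → 0 < δ → (∃ ξ : M, r < dist x ξ) →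
      ∃ s : ℝ, 0 < s ∧ (∃ ξ : M, dist x ξ = s) ∧ |s - r| < δ := by
  rintro x r δ hr hδ ⟨y, hy⟩
  have hε : 0 < min δ r := lt_min hδ hr
  have h_fin : chainDist (min δ r) x y ≠ ⊤ :=
    ne_top_of_le_ne_top ENNReal.ofReal_ne_top
      (hchain x y (min δ r) hε ((min_le_right δ r).trans_lt hy)).2
  obtain ⟨N, ξ, hξ⟩ := exists_isChainSeq_of_chainDist_ne_top h_fin
  obtain ⟨z, hz_ge, hz_lt⟩ := hξ.exists_dist_mem_Ico hr hy.le
  refine ⟨dist x z, hr.trans_le hz_ge, ⟨z, rfl⟩, ?_⟩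
  rw [abs_of_nonneg (sub_nonneg.mpr hz_ge)]
  linarith [min_le_left δ r]
end

section
/- Let (M,d) be a metric space satisfying the ρ-chain condition with constant C_ρ for a scale function ρ with β₁(ρ) ≥ 1, and let ψ_c be a scale function. Assume there is a constant C₅ > 0 such that ρ(r₂)/ρ(r₁) ≤ C₅ √(ψ_c(r₂)/ψ_c(r₁)) for all 0 < r₁ ≤ r₂. Let x, y ∈ M with x ≠ y, let 0 < ε < d(x,y), and set t := (ψ_c(ε)/ε)·d_ε(x,y). Then (1/4)(C_ρ C₅)⁻² · d_ε(x,y)/ε ≤ sup_{r>0} ( ρ(d(x,y))/ρ(r) − t/ψ_c(r) ) ≤ max( C_ρ, (1/4)(C_ρ C₅)² ) · d_ε(x,y)/ε. -/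
open scoped ENNReal

/-- The set of values `ρ(D)/ρ(r) − t/ψ_c(r)` over `r > 0`, whose supremum appears
in the sub-Gaussian exponent. -/
def supSet (ρ ψc : ℝ → ℝ) (D t : ℝ) : Set ℝ :=
  {v : ℝ | ∃ r : ℝ, 0 < r ∧ v = ρ D / ρ r - t / ψc r}

/-- A scale function attains every value above one of its values, further to the right. -/
theorem IsScale.exists_eq_of_le {φ : ℝ → ℝ} {C β₁ β₂ : ℝ} (hφ : IsScale φ C β₁ β₂)
    {s v : ℝ} (hs : 0 < s) (hv : φ s ≤ v) : ∃ r, s ≤ r ∧ φ r = v := by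
  obtain ⟨b, hsb, hb⟩ :=
    ((Filter.eventually_ge_atTop s).and (hφ.tendsto_top.eventually_ge_atTop v)).exists
  obtain ⟨r, hr, hrv⟩ := intermediate_value_Icc hsb
    (hφ.cont.mono fun z hz => Set.mem_Ioi.2 (hs.trans_le hz.1)) ⟨hv, hb⟩
  exact ⟨r, hr.1, hrv⟩

/-- The chain condition in terms of real numbers. -/
theorem RhoChainCond.toReal_bounds {M : Type*} [MetricSpace M] {ρ : ℝ → ℝ} {K : ℝ}
    (h : RhoChainCond M ρ K) (hρ : ∀ r, 0 < r → 0 < ρ r) (hK : 1 ≤ K) {x y : M} {ε : ℝ}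
    (hε : 0 < ε) (hεd : ε < dist x y) :
    ρ (dist x y) / ρ ε ≤ K * ((chainDist ε x y).toReal / ε) ∧
      (chainDist ε x y).toReal / ε ≤ K * (ρ (dist x y) / ρ ε) := by
  obtain ⟨hl, hu⟩ := h x y ε hε hεd
  have hK0 : 0 < K := by linarith
  have hA : 0 < ρ (dist x y) / ρ ε := div_pos (hρ _ (hε.trans hεd)) (hρ _ hε)
  have hu' := ENNReal.toReal_le_of_le_ofReal (by positivity) hu
  have hl' := (ENNReal.ofReal_le_iff_le_toReal (ne_top_of_le_ne_top ENNReal.ofReal_ne_top hu)).1 hl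
  refine ⟨?_, (div_le_iff₀ hε).2 hu'⟩
  rw [← inv_mul_le_iff₀ hK0]
  exact (le_div_iff₀ hε).2 hl'

/-- The square of a bound by a constant times a square root. -/
theorem sq_le_of_le_mul_sqrt {a c b : ℝ} (ha : 0 ≤ a) (hb : 0 ≤ b) (h : a ≤ c * √b) :
    a ^ 2 ≤ c ^ 2 * b := by
  have := pow_le_pow_left₀ ha h 2
  rwa [mul_pow, Real.sq_sqrt hb] at this

/-- Under the `ρ`-chain condition and the comparison
`ρ(r₂)/ρ(r₁) ≤ C₅ √(ψ_c(r₂)/ψ_c(r₁))`, for `0 < ε < d(x,y)` and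
`t = (ψ_c(ε)/ε)·d_ε(x,y)` one has
`(1/4)(C_ρ C₅)⁻² d_ε(x,y)/ε ≤ sup_{r>0}(ρ(d(x,y))/ρ(r) − t/ψ_c(r))
  ≤ max(C_ρ, (1/4)(C_ρ C₅)²) d_ε(x,y)/ε`. -/
theorem sup_comparable_chain_ratio {M : Type*} [MetricSpace M]
    (ρ ψc : ℝ → ℝ) (C₀ γ₁ γ₂ Cc β₁ β₂ Cρ C₅ : ℝ)
    (hρ : IsScale ρ C₀ γ₁ γ₂) (hγ₁ : 1 ≤ γ₁)
    (hψc : IsScale ψc Cc β₁ β₂)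
    (hCρ : 1 ≤ Cρ) (hchain : RhoChainCond M ρ Cρ)
    (hC₅ : 0 < C₅)
    (hcomp : ∀ r₁ r₂ : ℝ, 0 < r₁ → r₁ ≤ r₂ →
      ρ r₂ / ρ r₁ ≤ C₅ * Real.sqrt (ψc r₂ / ψc r₁))
    (x y : M) (hxy : x ≠ y) (ε : ℝ) (hε : 0 < ε) (hεd : ε < dist x y) :
    BddAbove (supSet ρ ψc (dist x y) (ψc ε / ε * (chainDist ε x y).toReal)) ∧
    (1 / 4) * ((Cρ * C₅)⁻¹) ^ 2 * ((chainDist ε x y).toReal / ε) ≤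
      sSup (supSet ρ ψc (dist x y) (ψc ε / ε * (chainDist ε x y).toReal)) ∧
    sSup (supSet ρ ψc (dist x y) (ψc ε / ε * (chainDist ε x y).toReal)) ≤
      max Cρ ((1 / 4) * (Cρ * C₅) ^ 2) * ((chainDist ε x y).toReal / ε) := by
  obtain ⟨hAE, hEA⟩ := hchain.toReal_bounds hρ.pos hCρ hε hεd
  have ht : ψc ε / ε * (chainDist ε x y).toReal = ψc ε * ((chainDist ε x y).toReal / ε) := by
    ring
  rw [ht]
  set E := (chainDist ε x y).toReal / ε
  have hρε := hρ.pos ε hε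
  have hψε := hψc.pos ε hε
  have hρD := hρ.pos _ (hε.trans hεd)
  have hCρ0 : 0 < Cρ := by linarith
  have hA : 0 < ρ (dist x y) / ρ ε := div_pos hρD hρε
  have hE : 0 < E := pos_of_mul_pos_right (hA.trans_le hAE) hCρ0.le
  have hval : ∀ r, 0 < r → ρ (dist x y) / ρ r - ψc ε * E / ψc r =
      ρ (dist x y) / ρ ε * (ρ ε / ρ r) - E * (ψc ε / ψc r) := by
    intro r hr
    have := hρ.pos r hr
    have := hψc.pos r hr
    field_simp
  set A := ρ (dist x y) / ρ ε
  have hC₅1 : 1 ≤ C₅ := by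
    have := hcomp ε ε hε le_rfl
    simpa [div_self hρε.ne', div_self hψε.ne'] using this
  have hub : ∀ v ∈ supSet ρ ψc (dist x y) (ψc ε * E),
      v ≤ max Cρ ((1 / 4) * (Cρ * C₅) ^ 2) * E := by
    rintro v ⟨r, hr, rfl⟩
    rw [hval r hr]
    have hρr := hρ.pos r hr
    have hψr := hψc.pos r hr
    have hu : 0 < ρ ε / ρ r := div_pos hρε hρr
    have hw : 0 < ψc ε / ψc r := div_pos hψε hψr
    rcases le_total ε r with h | h
    · have hu1 : ρ ε / ρ r ≤ 1 := (div_le_one hρr).2 (hρ.mono.monotoneOn hε hr h)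
      calc A * (ρ ε / ρ r) - E * (ψc ε / ψc r) ≤ Cρ * E := by
            nlinarith [mul_pos hE hw, mul_le_mul_of_nonneg_left hu1 hA.le]
        _ ≤ _ := mul_le_mul_of_nonneg_right (le_max_left _ _) hE.le
    · have hsq := sq_le_of_le_mul_sqrt hu.le hw.le (hcomp r ε hr h)
      generalize ρ ε / ρ r = u at *
      generalize ψc ε / ψc r = w at *
      calc A * u - E * w ≤ (1 / 4) * (Cρ * C₅) ^ 2 * E := by
            have h1 : A * u ≤ Cρ * E * u := mul_le_mul_of_nonneg_right hAE hu.le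
            have h2 : u ^ 2 / C₅ ^ 2 ≤ w := (div_le_iff₀' (by positivity)).2 hsq
            have h3 : Cρ * u - u ^ 2 / C₅ ^ 2 ≤ (1 / 4) * (Cρ * C₅) ^ 2 := by
              have h4 : (1 / 4) * (Cρ * C₅) ^ 2 - (Cρ * u - u ^ 2 / C₅ ^ 2) =
                  (Cρ * C₅ / 2 - u / C₅) ^ 2 := by
                field_simp
                ring
              nlinarith [sq_nonneg (Cρ * C₅ / 2 - u / C₅)]
            nlinarith [mul_le_mul_of_nonneg_left h2 hE.le, mul_le_mul_of_nonneg_left h3 hE.le]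
        _ ≤ _ := mul_le_mul_of_nonneg_right (le_max_right _ _) hE.le
  have hbdd : BddAbove (supSet ρ ψc (dist x y) (ψc ε * E)) := ⟨_, hub⟩
  refine ⟨hbdd, ?_, csSup_le ⟨_, ε, hε, rfl⟩ hub⟩
  have hc1 : 1 ≤ 2 * Cρ * C₅ ^ 2 := by nlinarith
  obtain ⟨r, hεr, hr⟩ := hρ.exists_eq_of_le hε (le_mul_of_one_le_left hρε.le hc1)
  have hr0 := hε.trans_le hεr
  have hψr := hψc.pos r hr0
  have hu : ρ ε / ρ r = 1 / (2 * Cρ * C₅ ^ 2) := by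
    rw [hr]
    field_simp
  have hw : ψc ε / ψc r ≤ 1 / (4 * Cρ ^ 2 * C₅ ^ 2) := by
    have hsq := sq_le_of_le_mul_sqrt (div_nonneg (hρ.pos r hr0).le hρε.le)
      (div_nonneg hψr.le hψε.le) (hcomp ε r hε hεr)
    rw [hr, mul_div_cancel_right₀ _ hρε.ne', ← mul_div_assoc, le_div_iff₀ hψε] at hsq
    rw [div_le_div_iff₀ hψr (by positivity)]
    have hc : 0 < C₅ ^ 2 := by positivity
    refine le_of_mul_le_mul_left ?_ hc
    linarith
  refine le_csSup_of_le hbdd ⟨r, hr0, rfl⟩ ?_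
  rw [hval r hr0, hu]
  have hEA' : E / Cρ ≤ A := (div_le_iff₀' hCρ0).2 hEA
  calc (1 / 4) * ((Cρ * C₅)⁻¹) ^ 2 * E
      = E / Cρ * (1 / (2 * Cρ * C₅ ^ 2)) - E * (1 / (4 * Cρ ^ 2 * C₅ ^ 2)) := by
        field_simp
        norm_num
    _ ≤ _ := by gcongr
end

section
/- Let φ be a scale function with lower exponent β := β₁(φ) > 1 and constant C := C(φ); φ is a continuous increasing bijection of (0,∞) with inverse φ⁻¹. For r, t > 0 set φ_*(r,t) := sup_{σ>0} ( r/σ − t/φ(σ) ). Then for all t > 0 and all r ≥ 2φ⁻¹(t): φ_*(r,t) = sup_{σ₁ ≤ σ ≤ 2φ⁻¹(t)} ( r/σ − t/φ(σ) ) ≥ r/(2φ⁻¹(t)), where σ₁ := (φ⁻¹(t))^{β/(β−1)} · (C r)^{−1/(β−1)}. -/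
open scoped ENNReal

/-- The cutoff `a ^ (β / (β - 1)) * b ^ (-(1 / (β - 1)))` solves `σ ^ (β - 1) * b = a ^ β`. -/
theorem cutoff_rpow_mul {a b β : ℝ} (ha : 0 < a) (hb : 0 < b) (hβ : 1 < β) :
    (a ^ (β / (β - 1)) * b ^ (-(1 / (β - 1)))) ^ (β - 1) * b = a ^ β := by
  have hβ' : β - 1 ≠ 0 := by linarith
  rw [Real.mul_rpow (by positivity) (by positivity), ← Real.rpow_mul ha.le,
    ← Real.rpow_mul hb.le, div_mul_cancel₀ _ hβ', neg_mul, one_div_mul_cancel hβ',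
    Real.rpow_neg_one, mul_assoc, inv_mul_cancel₀ hb.ne', mul_one]

/-- A point below the cutoff stays below `a`, provided `a ≤ b`. -/
theorem le_of_rpow_mul_le {a b σ β : ℝ} (ha : 0 < a) (hab : a ≤ b) (hβ : 1 < β)
    (h : σ ^ (β - 1) * b ≤ a ^ β) : σ ≤ a := by
  by_contra! hlt
  have hpow : a ^ (β - 1) < σ ^ (β - 1) := Real.rpow_lt_rpow ha.le hlt (by linarith)
  have hsplit : a ^ β = a ^ (β - 1) * a := by
    rw [← Real.rpow_add_one ha.ne', sub_add_cancel]
  have hpos : 0 < a ^ (β - 1) := by positivity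
  nlinarith

/-- Below the cutoff the function `σ ↦ r / σ - φ a / φ σ` is nonpositive. -/
theorem IsScale.div_le_div_of_rpow_mul_le {φ : ℝ → ℝ} {C β β₂ a r σ : ℝ}
    (hφ : IsScale φ C β β₂) (hβ : 1 < β) (ha : 0 < a) (har : a ≤ r) (hσ : 0 < σ)
    (h : σ ^ (β - 1) * (C * r) ≤ a ^ β) : r / σ ≤ φ a / φ σ := by
  have hC : 0 < C := zero_lt_one.trans_le hφ.one_le_C
  have hσa : σ ≤ a :=
    le_of_rpow_mul_le ha (by nlinarith [hφ.one_le_C]) hβ h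
  have hsplit : σ ^ β = σ ^ (β - 1) * σ := by
    rw [← Real.rpow_add_one hσ.ne', sub_add_cancel]
  have hpos : 0 < σ ^ (β - 1) := by positivity
  refine le_trans ?_ (hφ.lower σ a hσ hσa)
  rw [Real.div_rpow ha.le hσ.le, hsplit, inv_mul_eq_div, div_div,
    div_le_div_iff₀ hσ (by positivity)]
  calc r * (σ ^ (β - 1) * σ * C) = σ ^ (β - 1) * (C * r) * σ := by ring
    _ ≤ a ^ β * σ := by gcongr

/-- For a scale function `φ` with lower exponent `β > 1` and
constant `C`, for `t > 0` and `r ≥ 2φ⁻¹(t)` the supremum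
`φ_*(r,t) = sup_{σ>0}(r/σ − t/φ(σ))` is attained over
`σ₁ ≤ σ ≤ 2φ⁻¹(t)` with `σ₁ = (φ⁻¹(t))^{β/(β−1)}(Cr)^{−1/(β−1)}`, and
`φ_*(r,t) ≥ r/(2φ⁻¹(t))`. -/
theorem phiStar_restricted_sup (φ φinv : ℝ → ℝ) (C β β₂ : ℝ)
    (hφ : IsScale φ C β β₂) (hβ : 1 < β)
    (hinv₁ : ∀ r : ℝ, 0 < r → 0 < φinv r ∧ φ (φinv r) = r)
    (hinv₂ : ∀ r : ℝ, 0 < r → φinv (φ r) = r) :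
    ∀ t r : ℝ, 0 < t → 2 * φinv t ≤ r →
      BddAbove {v : ℝ | ∃ σ : ℝ, 0 < σ ∧ v = r / σ - t / φ σ} ∧
      sSup {v : ℝ | ∃ σ : ℝ, 0 < σ ∧ v = r / σ - t / φ σ} =
        sSup {v : ℝ | ∃ σ : ℝ,
          (φinv t) ^ (β / (β - 1)) * (C * r) ^ (-(1 / (β - 1))) ≤ σ ∧
          σ ≤ 2 * φinv t ∧ v = r / σ - t / φ σ} ∧
      r / (2 * φinv t) ≤ sSup {v : ℝ | ∃ σ : ℝ, 0 < σ ∧ v = r / σ - t / φ σ} := by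
  intro t r ht hr
  obtain ⟨ha, hat⟩ := hinv₁ t ht
  set a := φinv t
  have hr0 : 0 < r := by linarith
  have hC : 0 < C := zero_lt_one.trans_le hφ.one_le_C
  have hCr : a ≤ C * r := by nlinarith [hφ.one_le_C]
  set σ₁ := a ^ (β / (β - 1)) * (C * r) ^ (-(1 / (β - 1)))
  have hσ₁ : 0 < σ₁ := by positivity
  have hcut : σ₁ ^ (β - 1) * (C * r) = a ^ β := cutoff_rpow_mul ha (by positivity) hβ
  have hσ₁a : σ₁ ≤ a := le_of_rpow_mul_le ha hCr hβ hcut.le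
  have hsmall : ∀ σ, 0 < σ → σ ≤ σ₁ → r / σ - t / φ σ ≤ 0 := by
    intro σ hσ hle
    rw [sub_nonpos, ← hat]
    refine hφ.div_le_div_of_rpow_mul_le hβ ha (by linarith) hσ (le_of_le_of_eq ?_ hcut)
    have := Real.rpow_le_rpow hσ.le hle (by linarith : 0 ≤ β - 1)
    gcongr
  have hlarge : ∀ σ c, 0 < c → c ≤ σ → r / σ - t / φ σ ≤ r / c := by
    intro σ c hc hle
    have := div_pos ht (hφ.pos σ (hc.trans_le hle))
    have : r / σ ≤ r / c := by gcongr
    linarith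
  have hmid : r / (2 * a) ≤ r / a - t / φ a := by
    have h1 : 1 ≤ r / (2 * a) := (one_le_div (by positivity)).2 hr
    have h2 : r / a = 2 * (r / (2 * a)) := by field_simp
    rw [hat, div_self ht.ne', h2]
    linarith
  have hmid0 : 0 < r / (2 * a) := by positivity
  have hbdd : BddAbove {v : ℝ | ∃ σ : ℝ, 0 < σ ∧ v = r / σ - t / φ σ} := by
    refine ⟨r / σ₁, ?_⟩
    rintro _ ⟨σ, hσ, rfl⟩
    rcases le_total σ σ₁ with h | h
    · exact (hsmall σ hσ h).trans (by positivity)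
    · exact hlarge σ σ₁ hσ₁ h
  have hsub : {v : ℝ | ∃ σ : ℝ, σ₁ ≤ σ ∧ σ ≤ 2 * a ∧ v = r / σ - t / φ σ} ⊆
      {v : ℝ | ∃ σ : ℝ, 0 < σ ∧ v = r / σ - t / φ σ} := by
    rintro _ ⟨σ, h, -, rfl⟩
    exact ⟨σ, hσ₁.trans_le h, rfl⟩
  have hmem : r / a - t / φ a ∈
      {v : ℝ | ∃ σ : ℝ, σ₁ ≤ σ ∧ σ ≤ 2 * a ∧ v = r / σ - t / φ σ} :=
    ⟨a, hσ₁a, by linarith, rfl⟩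
  have hle := le_csSup (hbdd.mono hsub) hmem
  refine ⟨hbdd, le_antisymm (csSup_le ⟨_, hsub hmem⟩ ?_) (csSup_le_csSup hbdd ⟨_, hmem⟩ hsub),
    hmid.trans (le_csSup hbdd (hsub hmem))⟩
  rintro _ ⟨σ, hσ, rfl⟩
  rcases le_total σ σ₁ with h₁ | h₁
  · linarith [hsmall σ hσ h₁]
  rcases le_total σ (2 * a) with h₂ | h₂
  · exact le_csSup (hbdd.mono hsub) ⟨σ, h₁, h₂, rfl⟩
  · linarith [hlarge σ (2 * a) (by positivity) h₂]
end

section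
/- Let (M,d,μ) be a metric measure space satisfying the volume doubling condition VD with constant C_VD and exponent α₂, and assume (M,d) satisfies the ρ-chain condition for a scale function ρ with β₁(ρ) ≥ 1. Let ψ_j be a scale function and let J : M × M → [0,∞) be symmetric and satisfy, for some C_J ≥ 1 and all x ≠ y in M: C_J⁻¹ ≤ J(x,y) · V(x,d(x,y)) · ψ_j(d(x,y)) ≤ C_J, where V(x,r) = μ(B_d(x,r)). For ε > 0 set V_ε(x,r) := μ({y : d_ε(x,y) < r}). Then there exists a constant C' ≥ 1, independent of ε, such that for all ε > 0 and all x ≠ y in M: (C')⁻¹ ≤ J(x,y) · V_ε(x, d_ε(x,y)) · ψ_j(F_{ρ,ε}(d_ε(x,y))) ≤ C'. -/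
open scoped ENNReal

/-- The metric transform `F_{ρ,ε}`: identity up to `ε`, then `ρ⁻¹((r/ε)·ρ(ε))`. -/
noncomputable def Frho (ρ ρinv : ℝ → ℝ) (ε r : ℝ) : ℝ :=
  if r ≤ ε then r else ρinv (r / ε * ρ ε)

namespace IsScale

variable {φ : ℝ → ℝ} {C β₁ β₂ : ℝ}

lemma monotone_of_le (h : IsScale φ C β₁ β₂) {s t : ℝ} (hs : 0 < s) (hst : s ≤ t) : φ s ≤ φ t :=
  h.mono.monotoneOn (Set.mem_Ioi.2 hs) (Set.mem_Ioi.2 (hs.trans_le hst)) hst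

/-- If the lower exponent is at least one, comparability of values gives comparability of
arguments. -/
lemma le_mul_of_apply_le (h : IsScale φ C β₁ β₂) (hβ : 1 ≤ β₁) {A s t : ℝ} (hA : 1 ≤ A)
    (ht : 0 < t) (hle : φ s ≤ A * φ t) : s ≤ C * A * t := by
  have hC := h.one_le_C
  have hCA : 1 ≤ C * A := one_le_mul_of_one_le_of_one_le hC hA
  rcases le_total s t with hst | hst
  · exact hst.trans (le_mul_of_one_le_left ht.le hCA)
  · have hlow := h.lower t s ht hst
    have hone : 1 ≤ s / t := (one_le_div ht).2 hst
    have hpow : s / t ≤ (s / t) ^ β₁ := Real.self_le_rpow_of_one_le hone hβ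
    have hup : φ s / φ t ≤ A := (div_le_iff₀ (h.pos t ht)).2 hle
    have hC0 : 0 < C := by linarith
    have : (s / t) ^ β₁ ≤ C * A := (inv_mul_le_iff₀ hC0).1 (hlow.trans hup)
    exact (div_le_iff₀ ht).1 (hpow.trans this)

/-- Comparability of arguments gives comparability of values. -/
lemma apply_le_mul (h : IsScale φ C β₁ β₂) {K s t : ℝ} (hK : 1 ≤ K)
    (hs : 0 < s) (ht : 0 < t) (hle : s ≤ K * t) : φ s ≤ C * K ^ β₂ * φ t := by
  have hC := h.one_le_C
  have hβ₂ : 0 ≤ β₂ := h.beta1_pos.le.trans h.beta_le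
  have hone : 1 ≤ C * K ^ β₂ :=
    one_le_mul_of_one_le_of_one_le hC (Real.one_le_rpow hK hβ₂)
  rcases le_total s t with hst | hst
  · exact (h.monotone_of_le hs hst).trans (le_mul_of_one_le_left (h.pos t ht).le hone)
  · refine (div_le_iff₀ (h.pos t ht)).1 ((h.upper t s ht hst).trans ?_)
    have : s / t ≤ K := (div_le_iff₀ ht).2 hle
    have : 0 ≤ s / t := by positivity
    gcongr

end IsScale

section ChainDist

variable {M : Type*} [MetricSpace M] {ε : ℝ} {x y z : M}

lemma ofReal_dist_le_chainDist (ε : ℝ) (x y : M) :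
    ENNReal.ofReal (dist x y) ≤ chainDist ε x y := by
  refine le_iInf fun N => le_iInf fun ξ => le_iInf fun h => ENNReal.ofReal_le_ofReal ?_
  have := dist_le_range_sum_dist ξ (N + 1)
  rwa [h.1, h.2.1] at this

lemma chainDist_of_dist_lt (h : dist x y < ε) :
    chainDist ε x y = ENNReal.ofReal (dist x y) := by
  refine le_antisymm ?_ (ofReal_dist_le_chainDist ε x y)
  refine iInf_le_of_le 0 (iInf_le_of_le (fun i => if i = 0 then x else y)
    (iInf_le_of_le ⟨rfl, rfl, fun i hi => ?_⟩ ?_))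
  · obtain rfl : i = 0 := Nat.le_zero.1 hi
    simpa using h
  · simp

lemma chainDist_anti {δ : ℝ} (h : δ ≤ ε) (x y : M) : chainDist ε x y ≤ chainDist δ x y :=
  le_iInf fun N => le_iInf fun ξ => le_iInf fun hξ =>
    iInf_le_of_le N (iInf_le_of_le ξ
      (iInf_le_of_le ⟨hξ.1, hξ.2.1, fun i hi => (hξ.2.2 i hi).trans_le h⟩ le_rfl))

variable {ρ ρinv : ℝ → ℝ} {C₀ γ₁ γ₂ Cρ : ℝ}

/-- The chain condition extends to the boundary case `ε = dist x y`. -/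
lemma RhoChainCond.exists_bounds_of_le (hρ : IsScale ρ C₀ γ₁ γ₂) (hCρ : 1 ≤ Cρ)
    (hchain : RhoChainCond M ρ Cρ) :
    ∃ C₁ : ℝ, 1 ≤ C₁ ∧ ∀ ε : ℝ, 0 < ε → ∀ x y : M, ε ≤ dist x y →
      chainDist ε x y ≠ ⊤ ∧
      ρ (dist x y) ≤ C₁ * ((chainDist ε x y).toReal / ε * ρ ε) ∧
      (chainDist ε x y).toReal / ε * ρ ε ≤ C₁ * ρ (dist x y) := by
  have hC₀ := hρ.one_le_C
  have hγ₂ : 0 ≤ γ₂ := hρ.beta1_pos.le.trans hρ.beta_le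
  have hA : 1 ≤ C₀ * 2 ^ γ₂ :=
    one_le_mul_of_one_le_of_one_le hC₀ (Real.one_le_rpow one_le_two hγ₂)
  have hCA : Cρ ≤ Cρ * (C₀ * 2 ^ γ₂) := le_mul_of_one_le_right (by linarith) hA
  refine ⟨Cρ * (C₀ * 2 ^ γ₂), hCρ.trans hCA, fun ε hε x y hle => ?_⟩
  have hd : 0 < dist x y := hε.trans_le hle
  have hρε := hρ.pos ε hε
  have hρd := hρ.pos _ hd
  rcases hle.lt_or_eq with hlt | heq
  · obtain ⟨h₁, h₂⟩ := hchain x y ε hε hlt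
    have htop : chainDist ε x y ≠ ⊤ := ne_top_of_le_ne_top ENNReal.ofReal_ne_top h₂
    have h₁' := (ENNReal.ofReal_le_iff_le_toReal htop).1 h₁
    have h₂' := ENNReal.toReal_le_of_le_ofReal (by positivity) h₂
    refine ⟨htop, ?_, ?_⟩
    · calc ρ (dist x y) = Cρ * ((Cρ⁻¹ * (ρ (dist x y) / ρ ε) * ε) / ε * ρ ε) := by
            field_simp
        _ ≤ Cρ * (C₀ * 2 ^ γ₂) * ((chainDist ε x y).toReal / ε * ρ ε) := by gcongr
    · calc (chainDist ε x y).toReal / ε * ρ ε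
          ≤ (Cρ * (ρ (dist x y) / ρ ε) * ε) / ε * ρ ε := by gcongr
        _ = Cρ * ρ (dist x y) := by field_simp
        _ ≤ Cρ * (C₀ * 2 ^ γ₂) * ρ (dist x y) := by gcongr
  · have h₂ := (chainDist_anti (half_le_self hε.le) x y).trans
      (hchain x y (ε / 2) (half_pos hε) ((half_lt_self hε).trans_le hle)).2
    have hρh := hρ.pos _ (half_pos hε)
    have htop : chainDist ε x y ≠ ⊤ := ne_top_of_le_ne_top ENNReal.ofReal_ne_top h₂
    have h₁' := (ENNReal.ofReal_le_iff_le_toReal htop).1 (ofReal_dist_le_chainDist ε x y)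
    have h₂' := ENNReal.toReal_le_of_le_ofReal (by positivity) h₂
    rw [← heq] at h₁' h₂' ⊢
    refine ⟨htop, ?_, ?_⟩
    · have h₁ : 1 ≤ (chainDist ε x y).toReal / ε := (one_le_div hε).2 h₁'
      exact (le_mul_of_one_le_left hρε.le h₁).trans
        (le_mul_of_one_le_left (by positivity) (hCρ.trans hCA))
    · have hup : ρ ε / ρ (ε / 2) ≤ C₀ * 2 ^ γ₂ := by
        have := hρ.upper (ε / 2) ε (half_pos hε) (half_le_self hε.le)
        rwa [div_div_cancel₀ hε.ne'] at this
      have : (chainDist ε x y).toReal / ε ≤ Cρ * (C₀ * 2 ^ γ₂) := by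
        rw [div_le_iff₀ hε]
        refine h₂'.trans ?_
        gcongr
        linarith
      gcongr

/-- The chain metric, transformed by `Frho`, is uniformly comparable to the original metric, and
balls of the chain metric are uniformly comparable to balls of the original metric. -/
lemma RhoChainCond.exists_comparison (hρ : IsScale ρ C₀ γ₁ γ₂) (hγ₁ : 1 ≤ γ₁)
    (hinv₁ : ∀ r : ℝ, 0 < r → 0 < ρinv r ∧ ρ (ρinv r) = r)
    (hCρ : 1 ≤ Cρ) (hchain : RhoChainCond M ρ Cρ) :
    ∃ K : ℝ, 1 < K ∧ ∀ ε : ℝ, 0 < ε → ∀ x y : M, x ≠ y →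
      0 < Frho ρ ρinv ε (chainDist ε x y).toReal ∧
      Frho ρ ρinv ε (chainDist ε x y).toReal ≤ K * dist x y ∧
      dist x y ≤ K * Frho ρ ρinv ε (chainDist ε x y).toReal ∧
      Metric.ball x (dist x y / K) ⊆ {z | chainDist ε x z < chainDist ε x y} ∧
      {z | chainDist ε x z < chainDist ε x y} ⊆ Metric.ball x (K * dist x y) := by
  obtain ⟨C₁, hC₁, hbd⟩ := hchain.exists_bounds_of_le hρ hCρ
  have hC₀ := hρ.one_le_C
  have hL₁ : 1 ≤ C₀ * C₁ := one_le_mul_of_one_le_of_one_le hC₀ hC₁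
  have hCC : 1 ≤ C₁ * C₁ := one_le_mul_of_one_le_of_one_le hC₁ hC₁
  have hL₂ : C₀ * C₁ ≤ C₀ * (C₁ * C₁) := by
    rw [← mul_assoc]; exact le_mul_of_one_le_right (by linarith) hC₁
  obtain ⟨K, hKdef⟩ : ∃ K, K = 2 * (C₀ * (C₁ * C₁)) := ⟨_, rfl⟩
  have hK : 1 < K := by linarith
  have hLK : C₀ * (C₁ * C₁) < K := by linarith
  have hLK' : C₀ * C₁ ≤ K := by linarith
  refine ⟨K, hK, fun ε hε x y hxy => ?_⟩
  have hd : 0 < dist x y := dist_pos.2 hxy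
  have hdK : dist x y / K ≤ dist x y := div_le_self hd.le hK.le
  have hKd : dist x y < K * dist x y := lt_mul_of_one_lt_left hd hK
  rcases lt_or_ge (dist x y) ε with hlt | hge
  · have hD := chainDist_of_dist_lt hlt
    have hF : Frho ρ ρinv ε (chainDist ε x y).toReal = dist x y := by
      rw [hD, ENNReal.toReal_ofReal hd.le, Frho, if_pos hlt.le]
    rw [hF]
    refine ⟨hd, hKd.le, hKd.le, fun z hz => ?_, fun z hz => ?_⟩
    · rw [Metric.mem_ball'] at hz
      have hz' := hz.trans_le hdK
      rw [Set.mem_ofPred_eq, hD, chainDist_of_dist_lt (hz'.trans hlt)]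
      exact (ENNReal.ofReal_lt_ofReal_iff hd).2 hz'
    · rw [Set.mem_ofPred_eq, hD] at hz
      have := (ENNReal.ofReal_lt_ofReal_iff hd).1 ((ofReal_dist_le_chainDist ε x z).trans_lt hz)
      exact Metric.mem_ball'.2 (this.trans hKd)
  · obtain ⟨htop, h₁, h₂⟩ := hbd ε hε x y hge
    have hρε := hρ.pos ε hε
    have hdD := (ENNReal.ofReal_le_iff_le_toReal htop).1 (ofReal_dist_le_chainDist ε x y)
    have hr : 0 < (chainDist ε x y).toReal := hd.trans_le hdD
    have hFρ : 0 < Frho ρ ρinv ε (chainDist ε x y).toReal ∧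
        ρ (Frho ρ ρinv ε (chainDist ε x y).toReal) = (chainDist ε x y).toReal / ε * ρ ε := by
      unfold Frho
      split_ifs with hif
      · have : (chainDist ε x y).toReal = ε := le_antisymm hif (hge.trans hdD)
        rw [this, div_self hε.ne', one_mul]
        exact ⟨hε, rfl⟩
      · exact hinv₁ _ (by positivity)
    obtain ⟨hF, hρF⟩ := hFρ
    rw [← hρF] at h₁ h₂
    refine ⟨hF, ?_, ?_, fun z hz => ?_, fun z hz => ?_⟩
    · exact (hρ.le_mul_of_apply_le hγ₁ hC₁ hd h₂).trans (by gcongr)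
    · exact (hρ.le_mul_of_apply_le hγ₁ hC₁ hF h₁).trans (by gcongr)
    · rw [Metric.mem_ball'] at hz
      rw [Set.mem_ofPred_eq]
      rcases lt_or_ge (dist x z) ε with hzε | hzε
      · rw [chainDist_of_dist_lt hzε, ENNReal.ofReal_lt_iff_lt_toReal dist_nonneg htop]
        exact (hz.trans_le hdK).trans_le hdD
      · by_contra! hcon
        obtain ⟨hztop, -, hz₂⟩ := hbd ε hε x z hzε
        have hle := ENNReal.toReal_mono hztop hcon
        have hzpos := hε.trans_le hzε
        have : ρ (dist x y) ≤ C₁ * C₁ * ρ (dist x z) := by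
          calc ρ (dist x y) ≤ C₁ * ((chainDist ε x y).toReal / ε * ρ ε) := hρF ▸ h₁
            _ ≤ C₁ * ((chainDist ε x z).toReal / ε * ρ ε) := by gcongr
            _ ≤ C₁ * (C₁ * ρ (dist x z)) := by gcongr
            _ = C₁ * C₁ * ρ (dist x z) := by ring
        have := hρ.le_mul_of_apply_le hγ₁ hCC hzpos this
        rw [lt_div_iff₀ (by linarith)] at hz
        nlinarith
    · rw [Set.mem_ofPred_eq] at hz
      rw [Metric.mem_ball']
      rcases lt_or_ge (dist x z) ε with hzε | hzε
      · exact (hzε.trans_le hge).trans hKd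
      · obtain ⟨-, hz₁, -⟩ := hbd ε hε x z hzε
        have hle := ENNReal.toReal_mono htop hz.le
        have hzpos := hε.trans_le hzε
        have : ρ (dist x z) ≤ C₁ * C₁ * ρ (dist x y) := by
          calc ρ (dist x z) ≤ C₁ * ((chainDist ε x z).toReal / ε * ρ ε) := hz₁
            _ ≤ C₁ * ((chainDist ε x y).toReal / ε * ρ ε) := by gcongr
            _ ≤ C₁ * (C₁ * ρ (dist x y)) := by rw [← hρF]; gcongr
            _ = C₁ * C₁ * ρ (dist x y) := by ring
        exact (hρ.le_mul_of_apply_le hγ₁ hCC hd this).trans_lt (by gcongr)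

end ChainDist

/-- Under VD and the `ρ`-chain condition, a jump kernel `J`
comparable to `1/(V(x,d(x,y)) ψ_j(d(x,y)))` is, uniformly in `ε > 0`, comparable to
`1/(V_ε(x,d_ε(x,y)) ψ_j(F_{ρ,ε}(d_ε(x,y))))` with respect to the chain metric `d_ε`. -/
theorem jump_kernel_chain_metric {M : Type*} [MetricSpace M]
    [MeasurableSpace M] [BorelSpace M]
    (μ : MeasureTheory.Measure M)
    (ρ ρinv ψj : ℝ → ℝ) (J : M → M → ℝ)
    (C₀ γ₁ γ₂ Cρ CVD α₂ Cj βj₁ βj₂ CJ : ℝ)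
    (hρ : IsScale ρ C₀ γ₁ γ₂) (hγ₁ : 1 ≤ γ₁)
    (hinv₁ : ∀ r : ℝ, 0 < r → 0 < ρinv r ∧ ρ (ρinv r) = r)
    (hinv₂ : ∀ r : ℝ, 0 < r → ρinv (ρ r) = r)
    (hCρ : 1 ≤ Cρ) (hchain : RhoChainCond M ρ Cρ)
    (hψj : IsScale ψj Cj βj₁ βj₂)
    (hCVD : 1 ≤ CVD) (hα₂ : 0 < α₂)
    (hfull : ∀ (x : M) (r : ℝ), 0 < r →
      0 < μ (Metric.ball x r) ∧ μ (Metric.ball x r) < ⊤)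
    (hVD : ∀ (x : M) (r R : ℝ), 0 < r → r < R →
      μ (Metric.ball x R) ≤ ENNReal.ofReal (CVD * (R / r) ^ α₂) * μ (Metric.ball x r))
    (hJsymm : ∀ x y : M, J x y = J y x)
    (hJnonneg : ∀ x y : M, 0 ≤ J x y)
    (hCJ : 1 ≤ CJ)
    (hJ : ∀ x y : M, x ≠ y →
      CJ⁻¹ ≤ J x y * (μ (Metric.ball x (dist x y))).toReal * ψj (dist x y) ∧
      J x y * (μ (Metric.ball x (dist x y))).toReal * ψj (dist x y) ≤ CJ) :
    ∃ C' : ℝ, 1 ≤ C' ∧ ∀ ε : ℝ, 0 < ε → ∀ x y : M, x ≠ y →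
      C'⁻¹ ≤ J x y * (μ {z : M | chainDist ε x z < chainDist ε x y}).toReal *
          ψj (Frho ρ ρinv ε (chainDist ε x y).toReal) ∧
      J x y * (μ {z : M | chainDist ε x z < chainDist ε x y}).toReal *
          ψj (Frho ρ ρinv ε (chainDist ε x y).toReal) ≤ C' := by
  obtain ⟨K, hK, hcomp⟩ := hchain.exists_comparison hρ hγ₁ hinv₁ hCρ
  have hK₀ : 0 < K := by linarith
  obtain ⟨A, hA⟩ : ∃ A, A = CVD * K ^ α₂ := ⟨_, rfl⟩
  obtain ⟨B, hB⟩ : ∃ B, B = Cj * K ^ βj₂ := ⟨_, rfl⟩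
  have hA₁ : 1 ≤ A :=
    hA ▸ one_le_mul_of_one_le_of_one_le hCVD (Real.one_le_rpow hK.le hα₂.le)
  have hB₁ : 1 ≤ B := hB ▸ one_le_mul_of_one_le_of_one_le hψj.one_le_C
    (Real.one_le_rpow hK.le (hψj.beta1_pos.le.trans hψj.beta_le))
  refine ⟨A * B * CJ, one_le_mul_of_one_le_of_one_le
    (one_le_mul_of_one_le_of_one_le hA₁ hB₁) hCJ, fun ε hε x y hxy => ?_⟩
  obtain ⟨hF, hFd, hdF, hsub, hsup⟩ := hcomp ε hε x y hxy
  have hd : 0 < dist x y := dist_pos.2 hxy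
  have hdK : 0 < dist x y / K := by positivity
  have hKd : 0 < K * dist x y := by positivity
  have hdouble : ∀ r : ℝ, 0 < r → (μ (Metric.ball x (K * r))).toReal ≤
      A * (μ (Metric.ball x r)).toReal := by
    intro r hr
    have := hVD x r (K * r) hr (lt_mul_of_one_lt_left hr hK)
    rw [mul_div_cancel_right₀ K hr.ne', ← hA] at this
    have h := ENNReal.toReal_mono
      (ENNReal.mul_ne_top ENNReal.ofReal_ne_top (hfull x r hr).2.ne) this
    rwa [ENNReal.toReal_mul, ENNReal.toReal_ofReal (by linarith)] at h
  have hSfin := ne_top_of_le_ne_top (hfull x _ hKd).2.ne (MeasureTheory.measure_mono hsup)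
  have hV₁ := (ENNReal.toReal_mono (hfull x _ hKd).2.ne
    (MeasureTheory.measure_mono hsup)).trans (hdouble _ hd)
  have hV₂ := hdouble _ hdK
  rw [mul_div_cancel₀ _ hK₀.ne'] at hV₂
  replace hV₂ := hV₂.trans (mul_le_mul_of_nonneg_left
    (ENNReal.toReal_mono hSfin (MeasureTheory.measure_mono hsub)) (by linarith))
  have hψ₁ := hψj.apply_le_mul hK.le hF hd hFd
  have hψ₂ := hψj.apply_le_mul hK.le hd hF hdF
  rw [← hB] at hψ₁ hψ₂
  have hψd := hψj.pos _ hd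
  have hψF := hψj.pos _ hF
  obtain ⟨hJ₁, hJ₂⟩ := hJ x y hxy
  have hj := hJnonneg x y
  set v := (μ (Metric.ball x (dist x y))).toReal
  set v' := (μ {z : M | chainDist ε x z < chainDist ε x y}).toReal
  set p := ψj (dist x y)
  set p' := ψj (Frho ρ ρinv ε (chainDist ε x y).toReal)
  have hv : 0 ≤ v := ENNReal.toReal_nonneg
  have hv' : 0 ≤ v' := ENNReal.toReal_nonneg
  constructor
  · rw [mul_inv, inv_mul_le_iff₀ (by positivity)]
    calc CJ⁻¹ ≤ J x y * v * p := hJ₁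
      _ ≤ J x y * (A * v') * (B * p') := by gcongr
      _ = A * B * (J x y * v' * p') := by ring
  · calc J x y * v' * p' ≤ J x y * (A * v) * (B * p) := by gcongr
      _ = A * B * (J x y * v * p) := by ring
      _ ≤ A * B * CJ := by gcongr
end

section
/- Let (M,d) be a metric space satisfying the chain condition: there exists C₀ ≥ 1 such that d_ε(x,y) ≤ C₀ d(x,y) for all x, y ∈ M and all ε > 0. Fix 0 < γ < 1 and let d^γ(x,y) := (d(x,y))^γ, which is a metric on M; write (d^γ)_ε for the chain distance computed in the metric space (M, d^γ). Then (M, d^γ) satisfies the ρ_γ-chain condition with ρ_γ(r) := r^{1/γ}: there exists a constant C ≥ 1 such that for all x, y ∈ M and all 0 < ε < d^γ(x,y): C⁻¹ d(x,y)/ε^{1/γ} ≤ (d^γ)_ε(x,y)/ε ≤ C d(x,y)/ε^{1/γ}. -/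
open scoped ENNReal

/-- `ξ 0 = x, …, ξ (N+1) = y` is an `ε`-chain from `x` to `y` with respect to the
distance function `d`. -/
def IsChainSeqGen {M : Type*} (d : M → M → ℝ) (ε : ℝ) (x y : M) (N : ℕ) (ξ : ℕ → M) : Prop :=
  ξ 0 = x ∧ ξ (N + 1) = y ∧ ∀ i ≤ N, d (ξ i) (ξ (i + 1)) < ε

/-- The chain distance `d_ε(x,y)` with respect to the distance function `d`:
the infimum of total lengths of `ε`-chains from `x` to `y`, `∞` if none exists. -/
noncomputable def chainDistGen {M : Type*} (d : M → M → ℝ) (ε : ℝ) (x y : M) : ℝ≥0∞ :=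
  ⨅ (N : ℕ) (ξ : ℕ → M) (_ : IsChainSeqGen d ε x y N ξ),
    ENNReal.ofReal (∑ i ∈ Finset.range (N + 1), d (ξ i) (ξ (i + 1)))

/-- The first `k` links of a chain with links shorter than `δ / 2` can be grouped greedily into
`n` links shorter than `δ`, each consuming length at least `δ / 2`, plus a remainder `r < δ / 2`. -/
lemma exists_coarse_chain {M : Type*} [PseudoMetricSpace M] {δ : ℝ} (hδ : 0 < δ) (ξ : ℕ → M)
    (k : ℕ) (hξ : ∀ i < k, dist (ξ i) (ξ (i + 1)) < δ / 2) :
    ∃ (n : ℕ) (η : ℕ → M) (r : ℝ), η 0 = ξ 0 ∧ (∀ i < n, dist (η i) (η (i + 1)) < δ) ∧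
      dist (η n) (ξ k) ≤ r ∧ r < δ / 2 ∧
      n * (δ / 2) + r ≤ ∑ i ∈ Finset.range k, dist (ξ i) (ξ (i + 1)) := by
  induction k with
  | zero => exact ⟨0, ξ, 0, rfl, by simp, by simp, by positivity, by simp⟩
  | succ k ih =>
    obtain ⟨n, η, r, h0, hη, hr, hrδ, hsum⟩ := ih fun i hi => hξ i (by omega)
    have hk := hξ k (by omega)
    have htri := dist_triangle (η n) (ξ k) (ξ (k + 1))
    rw [Finset.sum_range_succ]
    by_cases h : r + dist (ξ k) (ξ (k + 1)) < δ / 2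
    · exact ⟨n, η, _, h0, hη, by linarith, h, by linarith⟩
    · refine ⟨n + 1, fun i => if i ≤ n then η i else ξ (k + 1), 0, by simpa using h0, ?_,
        by simp, by positivity, ?_⟩
      · intro i hi
        rcases Nat.lt_succ_iff_lt_or_eq.mp hi with hi | rfl
        · simpa [hi.le, Nat.succ_le_of_lt hi] using hη i hi
        · simp
          linarith
      · push_cast
        linarith

/-- The snowflake length of a chain with links `dist ^ γ < ε` is at least the distance of its
endpoints times `ε / ε ^ (1 / γ)`. -/
lemma dist_mul_le_snowflake_sum {M : Type*} [PseudoMetricSpace M] {γ ε : ℝ} (hγ : 0 < γ)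
    (hγ1 : γ < 1) (hε : 0 < ε) {x y : M} {N : ℕ} {ξ : ℕ → M}
    (hξ : IsChainSeqGen (fun a b : M => dist a b ^ γ) ε x y N ξ) :
    dist x y / ε ^ (1 / γ) * ε ≤ ∑ i ∈ Finset.range (N + 1), dist (ξ i) (ξ (i + 1)) ^ γ := by
  obtain ⟨rfl, rfl, hlink⟩ := hξ
  have hδ : 0 < ε ^ (1 / γ) := Real.rpow_pos_of_pos hε _
  have hδγ : (ε ^ (1 / γ)) ^ γ = ε := by
    rw [← Real.rpow_mul hε.le, one_div_mul_cancel hγ.ne', Real.rpow_one]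
  calc dist (ξ 0) (ξ (N + 1)) / ε ^ (1 / γ) * ε
      ≤ (∑ i ∈ Finset.range (N + 1), dist (ξ i) (ξ (i + 1))) / ε ^ (1 / γ) * ε := by
        gcongr
        exact dist_le_range_sum_dist ξ (N + 1)
    _ = ∑ i ∈ Finset.range (N + 1), dist (ξ i) (ξ (i + 1)) / ε ^ (1 / γ) * ε := by
        rw [Finset.sum_div, Finset.sum_mul]
    _ ≤ _ := by
        refine Finset.sum_le_sum fun i hi => ?_
        have hi' := hlink i (Nat.lt_succ_iff.mp (Finset.mem_range.mp hi))
        set t := dist (ξ i) (ξ (i + 1))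
        have ht0 : 0 ≤ t := dist_nonneg
        have htδ : t ≤ ε ^ (1 / γ) := by
          refine le_of_lt ((Real.rpow_lt_rpow_iff ht0 hδ.le hγ).mp ?_)
          rw [hδγ]
          exact hi'
        have hq1 : t / ε ^ (1 / γ) ≤ 1 := (div_le_one hδ).mpr htδ
        have hq0 : 0 ≤ t / ε ^ (1 / γ) := by positivity
        calc t / ε ^ (1 / γ) * ε ≤ (t / ε ^ (1 / γ)) ^ γ * ε := by
              gcongr
              exact Real.self_le_rpow_of_le_one hq0 hq1 hγ1.le
          _ = t ^ γ := by
              rw [Real.div_rpow ht0 hδ.le, hδγ, div_mul_cancel₀ _ hε.ne']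

/-- If `(M,d)` satisfies the chain condition
`d_ε(x,y) ≤ C₀ d(x,y)`, then for `0 < γ < 1` the snowflake metric
`d^γ(x,y) = d(x,y)^γ` satisfies the `ρ_γ`-chain condition with `ρ_γ(r) = r^{1/γ}`:
`C⁻¹ d(x,y)/ε^{1/γ} ≤ (d^γ)_ε(x,y)/ε ≤ C d(x,y)/ε^{1/γ}` whenever
`0 < ε < d^γ(x,y)`. -/
theorem snowflake_rho_chain {M : Type*} [MetricSpace M] (C₀ γ : ℝ)
    (hC₀ : 1 ≤ C₀)
    (hchain : ∀ (x y : M) (ε : ℝ), 0 < ε →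
      chainDistGen (fun a b : M => dist a b) ε x y ≤ ENNReal.ofReal (C₀ * dist x y))
    (hγ : 0 < γ) (hγ1 : γ < 1) :
    ∃ C : ℝ, 1 ≤ C ∧ ∀ (x y : M) (ε : ℝ), 0 < ε → ε < dist x y ^ γ →
      ENNReal.ofReal (C⁻¹ * (dist x y / ε ^ (1 / γ)) * ε) ≤
        chainDistGen (fun a b : M => dist a b ^ γ) ε x y ∧
      chainDistGen (fun a b : M => dist a b ^ γ) ε x y ≤
        ENNReal.ofReal (C * (dist x y / ε ^ (1 / γ)) * ε) := by
  refine ⟨4 * C₀ + 1, by linarith, fun x y ε hε hεd => ?_⟩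
  have hδ : 0 < ε ^ (1 / γ) := Real.rpow_pos_of_pos hε _
  have hδγ : (ε ^ (1 / γ)) ^ γ = ε := by
    rw [← Real.rpow_mul hε.le, one_div_mul_cancel hγ.ne', Real.rpow_one]
  constructor
  · refine le_iInf fun N => le_iInf fun ξ => le_iInf fun hξ => ENNReal.ofReal_le_ofReal ?_
    refine le_trans ?_ (dist_mul_le_snowflake_sum hγ hγ1 hε hξ)
    have hC : (4 * C₀ + 1)⁻¹ ≤ 1 := inv_le_one_of_one_le₀ (by linarith)
    gcongr
    exact mul_le_of_le_one_left (by positivity) hC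
  · have hδd : ε ^ (1 / γ) < dist x y := by
      rwa [← Real.rpow_lt_rpow_iff hδ.le dist_nonneg hγ, hδγ]
    set δ := ε ^ (1 / γ)
    have hd : 0 < dist x y := hδ.trans hδd
    have hlt : chainDistGen (fun a b : M => dist a b) (δ / 2) x y
        < ENNReal.ofReal (2 * C₀ * dist x y) := by
      refine (hchain x y _ (half_pos hδ)).trans_lt ?_
      rw [ENNReal.ofReal_lt_ofReal_iff (by positivity)]
      nlinarith
    simp only [chainDistGen, iInf_lt_iff] at hlt
    obtain ⟨N, ξ, ⟨hx, hy, hξ⟩, hL⟩ := hlt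
    rw [ENNReal.ofReal_lt_ofReal_iff (by positivity)] at hL
    obtain ⟨n, η, r, h0, hη, hr, hrδ, hsum⟩ :=
      exists_coarse_chain hδ ξ (N + 1) fun i hi => hξ i (Nat.lt_succ_iff.mp hi)
    have hchain' : IsChainSeqGen (fun a b : M => dist a b ^ γ) ε x y n
        (fun i => if i ≤ n then η i else y) := by
      refine ⟨by simp [h0, hx], by simp, fun i hi => ?_⟩
      rw [← hδγ]
      refine Real.rpow_lt_rpow dist_nonneg ?_ hγ
      rcases hi.lt_or_eq with hi | rfl
      · simpa [hi.le, Nat.succ_le_of_lt hi] using hη i hi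
      · rw [hy] at hr
        simp
        linarith
    refine iInf_le_of_le n (iInf_le_of_le _ (iInf_le_of_le hchain' (ENNReal.ofReal_le_ofReal ?_)))
    refine (Finset.sum_le_card_nsmul _ _ ε fun i hi =>
      (hchain'.2.2 i (Nat.lt_succ_iff.mp (Finset.mem_range.mp hi))).le).trans ?_
    rw [Finset.card_range, nsmul_eq_mul]
    gcongr
    rw [← mul_div_assoc, le_div_iff₀ hδ]
    have hr0 : 0 ≤ r := dist_nonneg.trans hr
    push_cast
    nlinarith
end

section
/- Let (M,d) be a metric space satisfying the ρ-chain condition for a scale function ρ with β₁(ρ) ≥ 1, and let Φ be a scale function such that there exist C ≥ 1 and β > 1 with Φ(ρ⁻¹(t))/Φ(ρ⁻¹(s)) ≥ C⁻¹ (t/s)^{β} for all 0 < s ≤ t (i.e. the lower exponent of Φ∘ρ⁻¹ is greater than 1). Then for all x, y ∈ M: lim_{ε→0⁺} (Φ(ε)/ε) · d_ε(x,y) = 0. -/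
open scoped ENNReal

/-- The chain distance from a point to itself is zero. -/
theorem chainDist_self {M : Type*} [MetricSpace M] {ε : ℝ} (hε : 0 < ε) (x : M) :
    chainDist ε x x = 0 := by
  have hchain : IsChainSeq ε x x 0 (fun _ => x) := ⟨rfl, rfl, fun _ _ => by simpa using hε⟩
  refine le_antisymm ((iInf₂_le 0 (fun _ => x)).trans ((iInf_le _ hchain).trans ?_)) bot_le
  simp

/-- Upper bound for the rescaled chain distance by a positive power of `ρ ε`. -/
theorem scale_mul_chainDist_le {M : Type*} [MetricSpace M] {ρ ρinv Φ : ℝ → ℝ} {Cρ C β : ℝ}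
    (hρ : ∀ r : ℝ, 0 < r → 0 < ρ r) (hρmono : StrictMonoOn ρ (Set.Ioi 0))
    (hinv : ∀ r : ℝ, 0 < r → ρinv (ρ r) = r)
    (hCρ : 0 ≤ Cρ) (hchain : RhoChainCond M ρ Cρ)
    (hΦ : ∀ r : ℝ, 0 < r → 0 < Φ r) (hC : 0 < C)
    (hlow : ∀ s t : ℝ, 0 < s → s ≤ t → C⁻¹ * (t / s) ^ β ≤ Φ (ρinv t) / Φ (ρinv s))
    {x y : M} {ε : ℝ} (hε : 0 < ε) (hεd : ε < dist x y) :
    Φ ε / ε * (chainDist ε x y).toReal ≤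
      Cρ * C * Φ (dist x y) * (ρ ε / ρ (dist x y)) ^ (β - 1) := by
  have hd : 0 < dist x y := hε.trans hεd
  have hs := hρ ε hε
  have hR := hρ _ hd
  have hΦε := hΦ ε hε
  have hΦd := hΦ _ hd
  have hD : (chainDist ε x y).toReal ≤ Cρ * (ρ (dist x y) / ρ ε) * ε :=
    ENNReal.toReal_le_of_le_ofReal (by positivity) (hchain x y ε hε hεd).2
  have hl := hlow (ρ ε) (ρ (dist x y)) hs (hρmono hε hd hεd).le
  rw [hinv _ hε, hinv _ hd] at hl
  set q := ρ (dist x y) / ρ ε with hq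
  have hq0 : 0 < q := div_pos hR hs
  have hqβ : 0 < q ^ β := Real.rpow_pos_of_pos hq0 β
  have hΦle : Φ ε ≤ C * Φ (dist x y) / q ^ β := by
    rw [le_div_iff₀ hΦε] at hl
    rw [le_div_iff₀ hqβ]
    calc Φ ε * q ^ β = C * (C⁻¹ * q ^ β * Φ ε) := by field_simp
      _ ≤ C * Φ (dist x y) := by gcongr
  have hpow : (ρ ε / ρ (dist x y)) ^ (β - 1) = q / q ^ β := by
    rw [← inv_div, ← hq, Real.inv_rpow hq0.le, ← Real.rpow_neg hq0.le, neg_sub,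
      Real.rpow_sub hq0, Real.rpow_one]
  calc Φ ε / ε * (chainDist ε x y).toReal ≤ Φ ε / ε * (Cρ * q * ε) := by gcongr
    _ = Cρ * q * Φ ε := by field_simp
    _ ≤ Cρ * q * (C * Φ (dist x y) / q ^ β) := by gcongr
    _ = Cρ * C * Φ (dist x y) * (ρ ε / ρ (dist x y)) ^ (β - 1) := by rw [hpow]; ring

/-- Under the `ρ`-chain condition, if `Φ` is a scale function
such that `Φ∘ρ⁻¹` has lower exponent `β > 1` (with constant `C`), then for all
`x, y`: `(Φ(ε)/ε)·d_ε(x,y) → 0` as `ε → 0⁺`. -/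
theorem chain_scale_tendsto_zero {M : Type*} [MetricSpace M]
    (ρ ρinv Φ : ℝ → ℝ)
    (C₀ γ₁ γ₂ Cρ CΦ βΦ₁ βΦ₂ C β : ℝ)
    (hρ : IsScale ρ C₀ γ₁ γ₂) (hγ₁ : 1 ≤ γ₁)
    (hinv₁ : ∀ r : ℝ, 0 < r → 0 < ρinv r ∧ ρ (ρinv r) = r)
    (hinv₂ : ∀ r : ℝ, 0 < r → ρinv (ρ r) = r)
    (hCρ : 1 ≤ Cρ) (hchain : RhoChainCond M ρ Cρ)
    (hΦ : IsScale Φ CΦ βΦ₁ βΦ₂)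
    (hC : 1 ≤ C) (hβ : 1 < β)
    (hlow : ∀ s t : ℝ, 0 < s → s ≤ t →
      C⁻¹ * (t / s) ^ β ≤ Φ (ρinv t) / Φ (ρinv s)) :
    ∀ x y : M,
      Filter.Tendsto (fun ε : ℝ => Φ ε / ε * (chainDist ε x y).toReal)
        (nhdsWithin 0 (Set.Ioi 0)) (nhds 0) := by
  intro x y
  rcases eq_or_ne x y with rfl | hxy
  · refine tendsto_const_nhds.congr' ?_
    filter_upwards [self_mem_nhdsWithin] with ε hε
    simp [chainDist_self (Set.mem_Ioi.mp hε)]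
  have hd : 0 < dist x y := dist_pos.mpr hxy
  have hlim : Filter.Tendsto
      (fun ε => Cρ * C * Φ (dist x y) * (ρ ε / ρ (dist x y)) ^ (β - 1))
      (nhdsWithin 0 (Set.Ioi 0)) (nhds 0) := by
    have h := ((hρ.tendsto_zero.div_const (ρ (dist x y))).rpow_const
      (p := β - 1) (Or.inr (by linarith))).const_mul (Cρ * C * Φ (dist x y))
    simpa [Real.zero_rpow (sub_pos.mpr hβ).ne'] using h
  refine squeeze_zero' ?_ ?_ hlim
  · filter_upwards [self_mem_nhdsWithin] with ε hε
    have hε : 0 < ε := hε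
    have := hΦ.pos ε hε
    positivity
  · filter_upwards [Ioo_mem_nhdsGT hd] with ε hε
    exact scale_mul_chainDist_le hρ.pos hρ.mono hinv₂ (by linarith) hchain hΦ.pos
      (by linarith) hlow hε.1 hε.2
end

section
/- Let β ≥ 2 and 0 < r ≤ e⁻¹, and set t := r^β · log(1/r). Then ( β t / (2 log(1/t)) )^{1/β} ≤ r ≤ ( β t / log(1/t) )^{1/β}. (In particular 0 < t < 1, so log(1/t) > 0.) -/
/-- For `β ≥ 2` and `0 < r ≤ e⁻¹`, setting
`t = r^β log(1/r)`, one has `0 < t < 1` and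
`(β t/(2 log(1/t)))^{1/β} ≤ r ≤ (β t/log(1/t))^{1/β}`. -/
theorem inverse_of_rpow_log (β r : ℝ) (hβ : 2 ≤ β) (hr0 : 0 < r)
    (hre : r ≤ Real.exp (-1)) :
    0 < r ^ β * Real.log (1 / r) ∧
    r ^ β * Real.log (1 / r) < 1 ∧
    (β * (r ^ β * Real.log (1 / r)) /
        (2 * Real.log (1 / (r ^ β * Real.log (1 / r))))) ^ (1 / β) ≤ r ∧
    r ≤ (β * (r ^ β * Real.log (1 / r)) /
        Real.log (1 / (r ^ β * Real.log (1 / r)))) ^ (1 / β) := by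
  have hβ0 : 0 < β := by linarith
  have hL : 1 ≤ Real.log (1 / r) := by
    have h := Real.log_le_log hr0 hre
    rw [Real.log_exp] at h
    rw [one_div, Real.log_inv]
    linarith
  have hlogr : Real.log r = -Real.log (1 / r) := by
    rw [one_div, Real.log_inv, neg_neg]
  generalize Real.log (1 / r) = L at hL hlogr ⊢
  have hL0 : 0 < L := by linarith
  have hrβ : 0 < r ^ β := Real.rpow_pos_of_pos hr0 β
  have ht0 : 0 < r ^ β * L := mul_pos hrβ hL0
  have hlogt : Real.log (1 / (r ^ β * L)) = β * L - Real.log L := by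
    rw [one_div, Real.log_inv, Real.log_mul hrβ.ne' hL0.ne', Real.log_rpow hr0, hlogr]
    ring
  have hlogL0 : 0 ≤ Real.log L := Real.log_nonneg hL
  have hlogL : Real.log L ≤ L - 1 := Real.log_le_sub_one_of_pos hL0
  have hβL : 2 * L ≤ β * L := mul_le_mul_of_nonneg_right hβ hL0.le
  have hK0 : 0 < β * L - Real.log L := by linarith
  have hroot : (r ^ β) ^ (1 / β) = r := by
    rw [one_div, Real.rpow_rpow_inv hr0.le hβ0.ne']
  refine ⟨ht0, ?_, ?_, ?_⟩
  · rw [← Real.log_neg_iff ht0]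
    rw [one_div, Real.log_inv] at hlogt
    linarith
  · rw [hlogt]
    conv_rhs => rw [← hroot]
    refine Real.rpow_le_rpow (by positivity) ?_ (by positivity)
    rw [div_le_iff₀ (by positivity), mul_left_comm]
    exact mul_le_mul_of_nonneg_left (by linarith) hrβ.le
  · rw [hlogt]
    conv_lhs => rw [← hroot]
    refine Real.rpow_le_rpow hrβ.le ?_ (by positivity)
    rw [le_div_iff₀ hK0, mul_left_comm]
    exact mul_le_mul_of_nonneg_left (by linarith) hrβ.le
end

section
/- For τ ∈ (1/2, 1), define the quadratic f_τ(σ) := 2(2τ−1)σ² + 2(τ²−3τ+1)σ + τ(1−τ²). Then: (i) f_τ has exactly one root σ(τ) in the interval (1−τ, 1), and moreover σ(τ) < (1+τ)/2; (ii) this root satisfies σ(τ) ≥ τ if and only if τ ≤ 3/5. -/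
/-- A convex real quadratic that is nonpositive at `x` and negative at `z` is negative at every
point strictly between them. -/
theorem quadratic_neg_of_mem_Ioo {a b c x y z : ℝ} (ha : 0 ≤ a)
    (hx : a * x ^ 2 + b * x + c ≤ 0) (hz : a * z ^ 2 + b * z + c < 0)
    (hxy : x < y) (hyz : y < z) : a * y ^ 2 + b * y + c < 0 := by
  have hyx : 0 < y - x := sub_pos.2 hxy
  have hzy : 0 < z - y := sub_pos.2 hyz
  have hzx : 0 < z - x := sub_pos.2 (hxy.trans hyz)
  have h₁ := mul_nonpos_of_nonpos_of_nonneg hx hzy.le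
  have h₂ := mul_neg_of_neg_of_pos hz hyx
  have h₃ : 0 ≤ a * (y - x) * (z - y) * (z - x) := by positivity
  have h : (a * y ^ 2 + b * y + c) * (z - x) < 0 := by linarith
  exact neg_of_mul_neg_left h hzx.le


/-- For `τ ∈ (1/2, 1)`, the quadratic
`f_τ(σ) = 2(2τ−1)σ² + 2(τ²−3τ+1)σ + τ(1−τ²)` has exactly one root `σ(τ)` in
`(1−τ, 1)`; this root satisfies `σ(τ) < (1+τ)/2`, and `σ(τ) ≥ τ` iff `τ ≤ 3/5`. -/
theorem sg_renormalization_root (τ : ℝ) (hτ1 : 1 / 2 < τ) (hτ2 : τ < 1) :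
    (∃! σ : ℝ, σ ∈ Set.Ioo (1 - τ) 1 ∧
      2 * (2 * τ - 1) * σ ^ 2 + 2 * (τ ^ 2 - 3 * τ + 1) * σ + τ * (1 - τ ^ 2) = 0) ∧
    ∀ σ : ℝ, σ ∈ Set.Ioo (1 - τ) 1 →
      2 * (2 * τ - 1) * σ ^ 2 + 2 * (τ ^ 2 - 3 * τ + 1) * σ + τ * (1 - τ ^ 2) = 0 →
      σ < (1 + τ) / 2 ∧ (τ ≤ σ ↔ τ ≤ 3 / 5) := by
  have ha : 0 ≤ 2 * (2 * τ - 1) := by linarith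
  have hτ : 0 < τ := by linarith
  have hτ' : 0 < 1 - τ := by linarith
  have hpos : 0 < τ * (1 - τ) ^ 2 := by positivity
  set f : ℝ → ℝ := fun σ ↦
    2 * (2 * τ - 1) * σ ^ 2 + 2 * (τ ^ 2 - 3 * τ + 1) * σ + τ * (1 - τ ^ 2) with hf
  have f_left : f (1 - τ) = τ * (1 - τ) ^ 2 := by simp only [hf]; ring
  have f_one : f 1 = -(τ * (1 - τ) ^ 2) := by simp only [hf]; ring
  have f_mid : f ((1 + τ) / 2) = -((τ + 1) * (1 - τ) * (τ - 1 / 2)) := by simp only [hf]; ring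
  have f_self : f τ = τ * (1 - τ) * (3 - 5 * τ) := by simp only [hf]; ring
  have f_neg {x y : ℝ} (hx : f x ≤ 0) (hxy : x < y) (hy : y < 1) : f y < 0 :=
    quadratic_neg_of_mem_Ioo ha hx (show f 1 < 0 by linarith) hxy hy
  have le_of_root {x s : ℝ} (hx : 0 ≤ f x) (hx1 : x < 1) (hs : f s = 0) : x ≤ s :=
    not_lt.1 fun h ↦ (f_neg hs.le h hx1).not_ge hx
  have lt_of_root {x s : ℝ} (hx : f x < 0) (hs1 : s < 1) (hs : f s = 0) : s < x := by
    by_contra! h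
    rcases h.eq_or_lt with rfl | h
    · exact hx.ne hs
    · exact (f_neg hx.le h hs1).ne hs
  refine ⟨?_, fun σ hσ (hroot : f σ = 0) ↦ ⟨?_, fun h ↦ ?_, fun h ↦ ?_⟩⟩
  · have hcont : ContinuousOn f (Set.Icc (1 - τ) 1) := by fun_prop
    obtain ⟨s, hs, hroot⟩ := intermediate_value_Ioo' (by linarith) hcont
      (show (0 : ℝ) ∈ Set.Ioo (f 1) (f (1 - τ)) from ⟨by linarith, by linarith⟩)
    refine ⟨s, ⟨hs, hroot⟩, fun t ⟨ht, (ht0 : f t = 0)⟩ ↦ ?_⟩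
    exact le_antisymm (le_of_root ht0.ge ht.2 hroot) (le_of_root hroot.ge hs.2 ht0)
  · refine lt_of_root ?_ hσ.2 hroot
    rw [f_mid, neg_lt_zero]
    exact mul_pos (mul_pos (by linarith) hτ') (by linarith)
  · by_contra! hlt
    refine (lt_of_root ?_ hσ.2 hroot).not_ge h
    rw [f_self]
    exact mul_neg_of_pos_of_neg (mul_pos hτ hτ') (by linarith)
  · refine le_of_root ?_ hτ2 hroot
    rw [f_self]
    exact mul_nonneg (mul_pos hτ hτ').le (by linarith)
end
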